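/- arXiv:2012.04356 — 3 statements merged into one kernel-verified Lean document; each statement's English description precedes it below -/
import Mathlib

section
/- Let n ∈ (2,3) be a real number. There exists a constant C < ∞ depending only on n such that for all ε ∈ (0,1) and all r ∈ ℝ one has |∫_1^r (F_ε''(s))² ds| ≤ C (1 + G_ε(r)^{(3−n)/(n−2)}), where F_ε'' denotes the second derivative of F_ε. -/
open MeasureTheory

/-- `F_ε(r) = (r² + ε²)^(n/4)` -/
noncomputable def Feps (n ε r : ℝ) : ℝ := (r ^ 2 + ε ^ 2) ^ (n / 4)

/-- `G_ε(r) = ∫_r^∞ ∫_{r'}^∞ (r''² + ε²)^(-n/2) dr'' dr'` -/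
noncomputable def Geps (n ε r : ℝ) : ℝ :=
  ∫ r' in Set.Ioi r, ∫ r'' in Set.Ioi r', (r'' ^ 2 + ε ^ 2) ^ (-(n / 2))

/-- The second derivative of `Feps n ε`. -/
lemma iteratedDeriv_two_Feps (n : ℝ) {ε : ℝ} (hε : 0 < ε) (s : ℝ) :
    iteratedDeriv 2 (Feps n ε) s = (n / 2) * (s ^ 2 + ε ^ 2) ^ (n / 4 - 1)
      + n * (n / 4 - 1) * s ^ 2 * (s ^ 2 + ε ^ 2) ^ (n / 4 - 2) := by
  have hq (x : ℝ) : HasDerivAt (fun x : ℝ => x ^ 2 + ε ^ 2) (2 * x) x := by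
    simpa using (hasDerivAt_pow 2 x).add_const (ε ^ 2)
  have hpos (x : ℝ) : x ^ 2 + ε ^ 2 ≠ 0 := by positivity
  have h1 : deriv (Feps n ε) = fun x => 2 * x * (n / 4) * (x ^ 2 + ε ^ 2) ^ (n / 4 - 1) := by
    funext x
    exact ((hq x).rpow_const (Or.inl (hpos x))).deriv
  rw [iteratedDeriv_succ, iteratedDeriv_one, h1]
  have h2 : HasDerivAt (fun x : ℝ => 2 * x * (n / 4)) (2 * (n / 4)) s := by
    simpa using ((hasDerivAt_id s).const_mul 2).mul_const (n / 4)
  have h3 := h2.mul ((hq s).rpow_const (p := n / 4 - 1) (Or.inl (hpos s)))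
  refine h3.deriv.trans ?_
  rw [show n / 4 - 1 - 1 = n / 4 - 2 by ring]
  ring

lemma sq_iteratedDeriv_two_Feps_le {n ε : ℝ} (hn : n ∈ Set.Ioo (2 : ℝ) 3) (hε : 0 < ε) (s : ℝ) :
    (iteratedDeriv 2 (Feps n ε) s) ^ 2 ≤ 9 * (s ^ 2 + ε ^ 2) ^ (n / 2 - 2) := by
  obtain ⟨hn2, hn3⟩ := hn
  rw [iteratedDeriv_two_Feps n hε]
  have hq : 0 < s ^ 2 + ε ^ 2 := by positivity
  set q := s ^ 2 + ε ^ 2 with hqdef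
  have hsplit : q ^ (n / 4 - 1) = q ^ (n / 4 - 2) * q := by
    rw [← Real.rpow_add_one hq.ne']; congr 1; ring
  have hsq : q ^ (n / 2 - 2) = (q ^ (n / 4 - 1)) ^ 2 := by
    rw [← Real.rpow_natCast, ← Real.rpow_mul hq.le]; congr 1; push_cast; ring
  have hA : 0 < q ^ (n / 4 - 1) := Real.rpow_pos_of_pos hq _
  have hB : 0 < q ^ (n / 4 - 2) := Real.rpow_pos_of_pos hq _
  have hsB : s ^ 2 * q ^ (n / 4 - 2) ≤ q ^ (n / 4 - 1) := by
    rw [hsplit, mul_comm]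
    gcongr
    nlinarith [sq_nonneg ε]
  have hsB0 : 0 ≤ s ^ 2 * q ^ (n / 4 - 2) := by positivity
  rw [hsq, show (9 : ℝ) * (q ^ (n / 4 - 1)) ^ 2 = (3 * q ^ (n / 4 - 1)) ^ 2 by ring]
  set A := q ^ (n / 4 - 1)
  set B := s ^ 2 * q ^ (n / 4 - 2) with hBdef
  rw [show n * (n / 4 - 1) * s ^ 2 * q ^ (n / 4 - 2) = n * (n / 4 - 1) * B by rw [hBdef]; ring]
  have hc0 : 0 ≤ n * (1 - n / 4) := by nlinarith
  have hc1 : n * (1 - n / 4) ≤ 1 := by nlinarith [sq_nonneg (n - 2)]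
  have hcB0 := mul_nonneg hc0 hsB0
  have hcB : n * (1 - n / 4) * B ≤ A := by nlinarith
  apply sq_le_sq'
  · nlinarith
  · nlinarith

lemma continuous_sq_add_sq_rpow {ε : ℝ} (hε : 0 < ε) (p : ℝ) :
    Continuous fun s : ℝ => (s ^ 2 + ε ^ 2) ^ p :=
  (by fun_prop : Continuous fun s : ℝ => s ^ 2 + ε ^ 2).rpow_const
    fun s => Or.inl (by positivity)

/-- Bound for the integral of `(s² + ε²)^(n/2-2)` over an interval of nonnegative reals. -/
lemma integral_sq_add_sq_rpow_le {n ε a b : ℝ} (hn : n ∈ Set.Ioo (2 : ℝ) 3) (hε : 0 < ε)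
    (ha : 0 ≤ a) (hab : a ≤ b) :
    ∫ s in a..b, (s ^ 2 + ε ^ 2) ^ (n / 2 - 2) ≤ 2 * (a + ε) ^ (n - 3) / (3 - n) := by
  obtain ⟨hn2, hn3⟩ := hn
  have hcont : ContinuousOn (fun s : ℝ => 2 * (s + ε) ^ (n - 4)) (Set.uIcc a b) := by
    rw [Set.uIcc_of_le hab]
    refine continuousOn_const.mul (ContinuousOn.rpow_const (by fun_prop) fun s hs => Or.inl ?_)
    linarith [hs.1]
  have hmono : ∫ s in a..b, (s ^ 2 + ε ^ 2) ^ (n / 2 - 2)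
      ≤ ∫ s in a..b, 2 * (s + ε) ^ (n - 4) := by
    refine intervalIntegral.integral_mono_on hab
      ((continuous_sq_add_sq_rpow hε _).intervalIntegrable _ _) hcont.intervalIntegrable ?_
    intro s hs
    have hs0 : 0 < s + ε := by linarith [hs.1]
    have h1 : (s ^ 2 + ε ^ 2) ^ (n / 2 - 2) ≤ ((s + ε) ^ 2 / 2) ^ (n / 2 - 2) :=
      Real.rpow_le_rpow_of_nonpos (by positivity) (by nlinarith [sq_nonneg (s - ε)]) (by linarith)
    refine h1.trans ?_
    have h2 : ((s + ε) ^ 2 / 2) ^ (n / 2 - 2) = 2 ^ (2 - n / 2) * (s + ε) ^ (n - 4) := by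
      rw [Real.div_rpow (by positivity) (by norm_num), ← Real.rpow_natCast,
        ← Real.rpow_mul hs0.le, show 2 - n / 2 = -(n / 2 - 2) by ring,
        Real.rpow_neg (by norm_num)]
      rw [show ((2 : ℕ) : ℝ) * (n / 2 - 2) = n - 4 by push_cast; ring]
      field_simp
    rw [h2]
    gcongr
    calc (2 : ℝ) ^ (2 - n / 2) ≤ 2 ^ (1 : ℝ) :=
          Real.rpow_le_rpow_of_exponent_le (by norm_num) (by linarith)
      _ = 2 := Real.rpow_one 2
  refine hmono.trans ?_
  rw [intervalIntegral.integral_const_mul,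
    intervalIntegral.integral_comp_add_right (fun x => x ^ (n - 4)),
    integral_rpow (Or.inr ⟨by linarith, ?_⟩)]
  · rw [show n - 4 + 1 = n - 3 by ring, show 3 - n = -(n - 3) by ring, div_neg, mul_div_assoc,
      ← mul_neg, ← neg_div]
    have hpos : 0 < (b + ε) ^ (n - 3) := Real.rpow_pos_of_pos (by linarith) _
    refine mul_le_mul_of_nonneg_left ?_ (by norm_num)
    refine div_le_div_of_nonpos_of_le (by linarith) (by linarith)
  · rw [Set.uIcc_of_le (by linarith)]
    intro h
    linarith [h.1]

lemma abs_integral_sq_iteratedDeriv_two_Feps_le {n ε a b : ℝ} (hn : n ∈ Set.Ioo (2 : ℝ) 3)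
    (hε : 0 < ε) (hab : a ≤ b) :
    |∫ s in a..b, (iteratedDeriv 2 (Feps n ε) s) ^ 2|
      ≤ 9 * ∫ s in a..b, (s ^ 2 + ε ^ 2) ^ (n / 2 - 2) := by
  rw [← intervalIntegral.integral_const_mul, ← Real.norm_eq_abs]
  refine intervalIntegral.norm_integral_le_of_norm_le hab (Filter.Eventually.of_forall ?_)
    (((continuous_sq_add_sq_rpow hε _).const_smul (9 : ℝ)).intervalIntegrable _ _)
  intro s _
  rw [Real.norm_of_nonneg (sq_nonneg _)]
  exact sq_iteratedDeriv_two_Feps_le hn hε s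

/-- Bound for the left-hand side in terms of `max r 0 + ε`. -/
lemma abs_integral_one_sq_iteratedDeriv_two_Feps_le {n ε : ℝ} (hn : n ∈ Set.Ioo (2 : ℝ) 3)
    (hε : 0 < ε) (r : ℝ) :
    |∫ s in (1 : ℝ)..r, (iteratedDeriv 2 (Feps n ε) s) ^ 2|
      ≤ 36 / (3 - n) * (1 + (max r 0 + ε) ^ (n - 3)) := by
  have h3n : 0 < 3 - n := by linarith [hn.2]
  have hρ : 0 < (max r 0 + ε) ^ (n - 3) :=
    Real.rpow_pos_of_pos (by linarith [le_max_right r 0]) _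
  rcases le_total 1 r with hr | hr
  · have h1 : (1 + ε) ^ (n - 3) ≤ 1 :=
      Real.rpow_le_one_of_one_le_of_nonpos (by linarith) (by linarith)
    calc _ ≤ _ := abs_integral_sq_iteratedDeriv_two_Feps_le hn hε hr
      _ ≤ 9 * (2 * (1 + ε) ^ (n - 3) / (3 - n)) := by
        gcongr; exact integral_sq_add_sq_rpow_le hn hε zero_le_one hr
      _ = 36 / (3 - n) * ((1 + ε) ^ (n - 3) / 2) := by ring
      _ ≤ _ := by gcongr; linarith
  · rw [intervalIntegral.integral_symm, abs_neg]
    refine (abs_integral_sq_iteratedDeriv_two_Feps_le hn hε hr).trans ?_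
    rcases le_total 0 r with h0 | h0
    · rw [max_eq_left h0] at hρ ⊢
      calc _ ≤ 9 * (2 * (r + ε) ^ (n - 3) / (3 - n)) := by
            gcongr; exact integral_sq_add_sq_rpow_le hn hε h0 hr
        _ = 36 / (3 - n) * ((r + ε) ^ (n - 3) / 2) := by ring
        _ ≤ _ := by gcongr; linarith
    · rw [max_eq_right h0] at hρ ⊢
      have hi (u v : ℝ) := (continuous_sq_add_sq_rpow hε (n / 2 - 2)).intervalIntegrable
        (μ := volume) u v
      have heven : ∫ s in r..0, (s ^ 2 + ε ^ 2) ^ (n / 2 - 2)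
          = ∫ s in (0 : ℝ)..(-r), (s ^ 2 + ε ^ 2) ^ (n / 2 - 2) := by
        have h := intervalIntegral.integral_comp_neg (a := r) (b := 0)
          (fun s : ℝ => (s ^ 2 + ε ^ 2) ^ (n / 2 - 2))
        simp_rw [neg_sq, neg_zero] at h
        exact h
      rw [← intervalIntegral.integral_add_adjacent_intervals (hi r 0) (hi 0 1), heven]
      calc _ ≤ 9 * (2 * (0 + ε) ^ (n - 3) / (3 - n) + 2 * (0 + ε) ^ (n - 3) / (3 - n)) := by
            gcongr
            · exact integral_sq_add_sq_rpow_le hn hε le_rfl (by linarith)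
            · exact integral_sq_add_sq_rpow_le hn hε le_rfl zero_le_one
        _ = 36 / (3 - n) * (0 + ε) ^ (n - 3) := by ring
        _ ≤ _ := by gcongr; linarith

lemma sq_add_sq_rpow_neg_le {n ε s : ℝ} (hn : 0 < n) (hs : 0 < s) :
    (s ^ 2 + ε ^ 2) ^ (-(n / 2)) ≤ s ^ (-n) := by
  calc _ ≤ (s ^ 2) ^ (-(n / 2)) :=
        Real.rpow_le_rpow_of_nonpos (by positivity) (by nlinarith [sq_nonneg ε]) (by linarith)
    _ = s ^ (-n) := by
        rw [← Real.rpow_natCast, ← Real.rpow_mul hs.le]; congr 1; push_cast; ring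

lemma rpow_neg_le_sq_add_sq_rpow {n ε s : ℝ} (hn : 0 < n) (hε : 0 < ε) (hs : 0 ≤ s) :
    (s + ε) ^ (-n) ≤ (s ^ 2 + ε ^ 2) ^ (-(n / 2)) := by
  have hsε : 0 < s + ε := by linarith
  calc (s + ε) ^ (-n) = ((s + ε) ^ 2) ^ (-(n / 2)) := by
        rw [← Real.rpow_natCast, ← Real.rpow_mul hsε.le]; congr 1; push_cast; ring
    _ ≤ _ := Real.rpow_le_rpow_of_nonpos (by positivity)
        (by nlinarith [mul_nonneg hs hε.le]) (by linarith)

lemma integrableOn_sq_add_sq_rpow_neg {n ε : ℝ} (hn : 1 < n) (hε : 0 < ε) (r : ℝ) :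
    IntegrableOn (fun s : ℝ => (s ^ 2 + ε ^ 2) ^ (-(n / 2))) (Set.Ioi r) := by
  have hc := continuous_sq_add_sq_rpow hε (-(n / 2))
  have h1 : IntegrableOn (fun s : ℝ => (s ^ 2 + ε ^ 2) ^ (-(n / 2))) (Set.Ioi 1) := by
    refine (integrableOn_Ioi_rpow_of_lt (by linarith : -n < -1) one_pos).mono'
      hc.aestronglyMeasurable ((ae_restrict_iff' measurableSet_Ioi).2 (.of_forall fun s hs => ?_))
    rw [Real.norm_of_nonneg (by positivity)]
    exact sq_add_sq_rpow_neg_le (by linarith) (one_pos.trans hs)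
  refine ((hc.integrableOn_Icc (a := r) (b := 1)).union h1).mono_set fun s hs => ?_
  rcases le_or_gt s 1 with h | h
  · exact Or.inl ⟨le_of_lt hs, h⟩
  · exact Or.inr h

lemma antitone_integral_Ioi_sq_add_sq_rpow_neg {n ε : ℝ} (hn : 1 < n) (hε : 0 < ε) :
    Antitone fun r : ℝ => ∫ s in Set.Ioi r, (s ^ 2 + ε ^ 2) ^ (-(n / 2)) := fun a _ hab =>
  setIntegral_mono_set (integrableOn_sq_add_sq_rpow_neg hn hε a)
    (.of_forall fun s => by positivity) (Set.Ioi_subset_Ioi hab).eventuallyLE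

lemma integrableOn_integral_Ioi_sq_add_sq_rpow_neg {n ε : ℝ} (hn : 2 < n) (hε : 0 < ε) (r : ℝ) :
    IntegrableOn (fun r' : ℝ => ∫ s in Set.Ioi r', (s ^ 2 + ε ^ 2) ^ (-(n / 2))) (Set.Ioi r) := by
  have ha := antitone_integral_Ioi_sq_add_sq_rpow_neg (n := n) (by linarith) hε
  have h1 : IntegrableOn (fun r' : ℝ => ∫ s in Set.Ioi r', (s ^ 2 + ε ^ 2) ^ (-(n / 2)))
      (Set.Ioi 1) := by
    refine ((integrableOn_Ioi_rpow_of_lt (by linarith : -n + 1 < -1) one_pos).neg.div_const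
      (-n + 1)).mono' ha.measurable.aestronglyMeasurable
      ((ae_restrict_iff' measurableSet_Ioi).2 (.of_forall fun t ht => ?_))
    have ht0 : 0 < t := one_pos.trans ht
    rw [Real.norm_of_nonneg (integral_nonneg fun s => by positivity)]
    simp only [Pi.neg_apply]
    rw [← integral_Ioi_rpow_of_lt (by linarith : -n < -1) ht0]
    exact setIntegral_mono_on (integrableOn_sq_add_sq_rpow_neg (by linarith) hε t)
      (integrableOn_Ioi_rpow_of_lt (by linarith) ht0) measurableSet_Ioi
      fun s hs => sq_add_sq_rpow_neg_le (by linarith) (ht0.trans hs)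
  refine (((ha.antitoneOn _).integrableOn_isCompact (isCompact_Icc (a := r) (b := 1))).union
    h1).mono_set fun s hs => ?_
  rcases le_or_gt s 1 with h | h
  · exact Or.inl ⟨le_of_lt hs, h⟩
  · exact Or.inr h

lemma integral_Ioi_add_rpow {ε p r : ℝ} (hp : p < -1) (hr : 0 < r + ε) :
    ∫ s in Set.Ioi r, (s + ε) ^ p = (r + ε) ^ (p + 1) / (-(p + 1)) := by
  have h := (measurePreserving_add_right volume ε).setIntegral_preimage_emb
    (measurableEmbedding_addRight ε) (fun x : ℝ => x ^ p) (Set.Ioi (r + ε))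
  rw [Set.preimage_add_const_Ioi, add_sub_cancel_right] at h
  rw [h, integral_Ioi_rpow_of_lt hp hr, div_neg, neg_div]

lemma le_integral_Ioi_sq_add_sq_rpow_neg {n ε r : ℝ} (hn : 1 < n) (hε : 0 < ε) (hr : 0 ≤ r) :
    (r + ε) ^ (1 - n) / (n - 1) ≤ ∫ s in Set.Ioi r, (s ^ 2 + ε ^ 2) ^ (-(n / 2)) := by
  have h := integral_Ioi_add_rpow (by linarith : -n < -1) (by linarith : 0 < r + ε)
  rw [show -n + 1 = 1 - n by ring, neg_sub] at h
  rw [← h]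
  exact setIntegral_mono_on (integrableOn_add_rpow_Ioi_of_lt (by linarith) (by linarith))
    (integrableOn_sq_add_sq_rpow_neg hn hε r) measurableSet_Ioi
    fun s hs => rpow_neg_le_sq_add_sq_rpow (by linarith) hε (hr.trans (le_of_lt hs))

lemma le_Geps {n ε : ℝ} (hn : 2 < n) (hε : 0 < ε) (r : ℝ) :
    (max r 0 + ε) ^ (2 - n) / ((n - 2) * (n - 1)) ≤ Geps n ε r := by
  have hr : 0 ≤ max r 0 := le_max_right _ _
  have h := integral_Ioi_add_rpow (by linarith : 1 - n < -1) (by linarith : 0 < max r 0 + ε)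
  rw [show 1 - n + 1 = 2 - n by ring, neg_sub] at h
  rw [← div_div, ← h, ← integral_div]
  calc _ ≤ Geps n ε (max r 0) :=
        setIntegral_mono_on
          ((integrableOn_add_rpow_Ioi_of_lt (by linarith) (by linarith)).div_const _)
          (integrableOn_integral_Ioi_sq_add_sq_rpow_neg hn hε _) measurableSet_Ioi
          fun t ht => le_integral_Ioi_sq_add_sq_rpow_neg (by linarith) hε (hr.trans (le_of_lt ht))
    _ ≤ Geps n ε r :=
        setIntegral_mono_set (integrableOn_integral_Ioi_sq_add_sq_rpow_neg hn hε r)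
          (.of_forall fun t => integral_nonneg fun s => by positivity)
          (Set.Ioi_subset_Ioi (le_max_left r 0)).eventuallyLE

/-- For `n ∈ (2,3)` there is a constant `C` depending only on `n` such that
for all `ε ∈ (0,1)` and all `r`,
`|∫_1^r (F_ε''(s))² ds| ≤ C (1 + G_ε(r)^((3-n)/(n-2)))`. -/
theorem int_Feps_second_deriv_sq_le_n_lt_three (n : ℝ) (hn : n ∈ Set.Ioo (2 : ℝ) 3) :
    ∃ C : ℝ, ∀ ε ∈ Set.Ioo (0 : ℝ) 1, ∀ r : ℝ,
      |∫ s in (1 : ℝ)..r, (iteratedDeriv 2 (Feps n ε) s) ^ 2|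
        ≤ C * (1 + (Geps n ε r) ^ ((3 - n) / (n - 2))) := by
  have hn2 : 0 < n - 2 := by linarith [hn.1]
  have hn3 : 0 < 3 - n := by linarith [hn.2]
  have hκ : 0 < (n - 2) * (n - 1) := mul_pos hn2 (by linarith)
  set K := ((n - 2) * (n - 1)) ^ ((3 - n) / (n - 2))
  have hK : 0 < K := Real.rpow_pos_of_pos hκ _
  refine ⟨36 / (3 - n) * (1 + K), fun ε hε r => ?_⟩
  have hρ : 0 < max r 0 + ε := by linarith [hε.1, le_max_right r 0]
  have hG := le_Geps hn.1 hε.1 r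
  have hG0 : 0 < Geps n ε r := lt_of_lt_of_le (by positivity) hG
  have key : (max r 0 + ε) ^ (n - 3) ≤ K * (Geps n ε r) ^ ((3 - n) / (n - 2)) := by
    rw [← Real.mul_rpow hκ.le hG0.le]
    calc (max r 0 + ε) ^ (n - 3) = ((max r 0 + ε) ^ (2 - n)) ^ ((3 - n) / (n - 2)) := by
          rw [← Real.rpow_mul hρ.le]; congr 1; field_simp; ring
      _ ≤ _ := by
          gcongr
          rwa [div_le_iff₀' hκ] at hG
  have hP : 0 < (Geps n ε r) ^ ((3 - n) / (n - 2)) := Real.rpow_pos_of_pos hG0 _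
  refine (abs_integral_one_sq_iteratedDeriv_two_Feps_le hn hε.1 r).trans ?_
  rw [mul_assoc]
  gcongr
  nlinarith
end

section
/- Let n > 2 be a real number. For all ε > 0 and all r ∈ ℝ one has (r² + ε²)^{(2−n)/2} ≤ (n−1)(n−2) G_ε(r). -/
open MeasureTheory

open Filter Topology

theorem integrable_sq_add_sq_rpow {p ε : ℝ} (hp : 1 < p) (hε : 0 < ε) :
    Integrable fun x : ℝ => (x ^ 2 + ε ^ 2) ^ (-(p / 2)) := by
  have h1 : Integrable fun x : ℝ => (1 + ‖x‖ ^ 2) ^ (-p / 2) :=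
    integrable_rpow_neg_one_add_norm_sq (by simpa using hp)
  have h2 := (h1.comp_div hε.ne').const_mul ((ε ^ 2) ^ (-(p / 2)))
  refine h2.congr (Eventually.of_forall fun x => ?_)
  dsimp only
  rw [neg_div, ← Real.mul_rpow (by positivity) (by positivity)]
  congr 1
  rw [Real.norm_eq_abs, sq_abs]
  field_simp
  ring

theorem tendsto_sq_add_sq_rpow_neg (ε : ℝ) {q : ℝ} (hq : 0 < q) :
    Tendsto (fun x : ℝ => (x ^ 2 + ε ^ 2) ^ (-q)) atTop (𝓝 0) :=
  (tendsto_rpow_neg_atTop hq).comp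
    (tendsto_atTop_add_const_right _ _ (tendsto_pow_atTop two_ne_zero))

theorem hasDerivAt_sq_add_sq_rpow {ε : ℝ} (hε : 0 < ε) (q x : ℝ) :
    HasDerivAt (fun x : ℝ => (x ^ 2 + ε ^ 2) ^ q)
      (2 * q * (x * (x ^ 2 + ε ^ 2) ^ (q - 1))) x := by
  have h : HasDerivAt (fun x : ℝ => x ^ 2 + ε ^ 2) (2 * x) x := by
    simpa using (hasDerivAt_pow 2 x).add_const (ε ^ 2)
  convert h.rpow_const (p := q) (Or.inl (by positivity)) using 1
  ring

theorem abs_mul_sq_add_sq_rpow_le {ε : ℝ} (hε : 0 < ε) (p x : ℝ) :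
    |x * (x ^ 2 + ε ^ 2) ^ (-(p / 2))| ≤ (x ^ 2 + ε ^ 2) ^ (-((p - 1) / 2)) := by
  have hs : 0 < x ^ 2 + ε ^ 2 := by positivity
  have e : -((p - 1) / 2) = 1 / 2 + -(p / 2) := by ring
  rw [abs_mul, abs_of_nonneg (Real.rpow_nonneg hs.le _), e, Real.rpow_add hs, ← Real.sqrt_eq_rpow]
  gcongr
  exact Real.abs_le_sqrt (by nlinarith)

/-- The tail integrals of `(x² + ε²)^(-n/2)` are integrable at `+∞` when `n > 2`. -/
theorem integrableOn_integral_Ioi_sq_add_sq_rpow {n ε : ℝ} (hn : 2 < n) (hε : 0 < ε) (r : ℝ) :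
    IntegrableOn (fun a : ℝ => ∫ x in Set.Ioi a, (x ^ 2 + ε ^ 2) ^ (-(n / 2))) (Set.Ioi r) := by
  have hw := integrable_sq_add_sq_rpow (p := n) (by linarith) hε
  have hnonneg (x : ℝ) : 0 ≤ (x ^ 2 + ε ^ 2) ^ (-(n / 2)) := by positivity
  have hanti : Antitone fun a : ℝ => ∫ x in Set.Ioi a, (x ^ 2 + ε ^ 2) ^ (-(n / 2)) :=
    fun a b hab => setIntegral_mono_set hw.integrableOn (ae_of_all _ hnonneg)
      (Set.Ioi_subset_Ioi hab).eventuallyLE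
  set m := max r 1
  have hm : 0 < m := lt_of_lt_of_le one_pos (le_max_right _ _)
  have hsub : Set.Ioi r ⊆ Set.Icc r m ∪ Set.Ioi m := fun x hx => by
    rcases le_or_gt x m with h | h
    exacts [Or.inl ⟨le_of_lt hx, h⟩, Or.inr h]
  refine IntegrableOn.mono_set (IntegrableOn.union ?_ ?_) hsub
  · exact (hanti.antitoneOn _).integrableOn_isCompact isCompact_Icc
  · have hb : IntegrableOn (fun a : ℝ => -a ^ (-n + 1) / (-n + 1)) (Set.Ioi m) :=
      ((integrableOn_Ioi_rpow_of_lt (by linarith) hm).neg).div_const _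
    refine Integrable.mono' hb hanti.measurable.aestronglyMeasurable ?_
    filter_upwards [ae_restrict_mem measurableSet_Ioi] with a ha
    have ha0 : 0 < a := hm.trans ha
    rw [Real.norm_of_nonneg (integral_nonneg hnonneg),
      ← integral_Ioi_rpow_of_lt (by linarith : -n < -1) ha0]
    refine setIntegral_mono_on hw.integrableOn (integrableOn_Ioi_rpow_of_lt (by linarith) ha0)
      measurableSet_Ioi fun x hx => ?_
    have hx0 : 0 < x := ha0.trans hx
    calc (x ^ 2 + ε ^ 2) ^ (-(n / 2)) ≤ (x ^ 2) ^ (-(n / 2)) :=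
          Real.rpow_le_rpow_of_nonpos (by positivity) (by nlinarith) (by linarith)
      _ = x ^ (-n) := by
          rw [← Real.rpow_natCast, ← Real.rpow_mul hx0.le]
          congr 1
          push_cast
          ring

/-- Obtained by integrating the derivative of `-x (x² + ε²)^(-n/2)` over `(a, ∞)`. -/
theorem mul_sq_add_sq_rpow_le_integral_Ioi {n ε : ℝ} (hn : 2 < n) (hε : 0 < ε) (a : ℝ) :
    a * (a ^ 2 + ε ^ 2) ^ (-(n / 2)) ≤
      (n - 1) * ∫ x in Set.Ioi a, (x ^ 2 + ε ^ 2) ^ (-(n / 2)) := by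
  have hw := integrable_sq_add_sq_rpow (p := n) (by linarith) hε
  set f' : ℝ → ℝ := fun x => (n * (x ^ 2 / (x ^ 2 + ε ^ 2)) - 1) * (x ^ 2 + ε ^ 2) ^ (-(n / 2))
  have hd (x : ℝ) : HasDerivAt (fun x : ℝ => -(x * (x ^ 2 + ε ^ 2) ^ (-(n / 2)))) (f' x) x := by
    refine ((hasDerivAt_id x).mul (hasDerivAt_sq_add_sq_rpow hε (-(n / 2)) x)).neg.congr_deriv ?_
    have hs : 0 < x ^ 2 + ε ^ 2 := by positivity
    simp only [f', Real.rpow_sub_one hs.ne', id]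
    field_simp
    ring
  have hq (x : ℝ) : 0 ≤ x ^ 2 / (x ^ 2 + ε ^ 2) ∧ x ^ 2 / (x ^ 2 + ε ^ 2) ≤ 1 :=
    ⟨by positivity, div_le_one_of_le₀ (by nlinarith) (by positivity)⟩
  have hle (x : ℝ) : f' x ≤ (n - 1) * (x ^ 2 + ε ^ 2) ^ (-(n / 2)) := by
    refine mul_le_mul_of_nonneg_right ?_ (by positivity)
    nlinarith [hq x]
  have hf' : Integrable f' := by
    refine Integrable.mono' (hw.const_mul (n - 1)) ?_ (ae_of_all _ fun x => ?_)
    · have : f' = deriv (fun x : ℝ => -(x * (x ^ 2 + ε ^ 2) ^ (-(n / 2)))) :=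
        funext fun x => (hd x).deriv.symm
      rw [this]
      exact (measurable_deriv _).aestronglyMeasurable
    · refine abs_le.2 ⟨?_, hle x⟩
      rw [← neg_mul]
      refine mul_le_mul_of_nonneg_right ?_ (by positivity)
      nlinarith [hq x]
  have hlim : Tendsto (fun x : ℝ => -(x * (x ^ 2 + ε ^ 2) ^ (-(n / 2)))) atTop (𝓝 0) := by
    refine squeeze_zero_norm (fun x => ?_)
      (tendsto_sq_add_sq_rpow_neg ε (by linarith : 0 < (n - 1) / 2))
    rw [norm_neg]
    exact abs_mul_sq_add_sq_rpow_le hε n x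
  have hint := integral_Ioi_of_hasDerivAt_of_tendsto' (fun x (_ : x ∈ Set.Ici a) => hd x)
    hf'.integrableOn hlim
  calc a * (a ^ 2 + ε ^ 2) ^ (-(n / 2)) = ∫ x in Set.Ioi a, f' x := by rw [hint]; ring
    _ ≤ ∫ x in Set.Ioi a, (n - 1) * (x ^ 2 + ε ^ 2) ^ (-(n / 2)) :=
        integral_mono hf'.integrableOn (hw.const_mul _).integrableOn hle
    _ = _ := integral_const_mul _ _

/-- For `n > 2`, all `ε > 0` and all `r`,
`(r² + ε²)^((2-n)/2) ≤ (n-1)(n-2) G_ε(r)`. -/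
theorem rpow_le_Geps (n : ℝ) (hn : 2 < n) (ε : ℝ) (hε : 0 < ε) (r : ℝ) :
    (r ^ 2 + ε ^ 2) ^ ((2 - n) / 2) ≤ (n - 1) * (n - 2) * Geps n ε r := by
  have hd (x : ℝ) : HasDerivAt (fun x : ℝ => (x ^ 2 + ε ^ 2) ^ ((2 - n) / 2))
      (-((n - 2) * (x * (x ^ 2 + ε ^ 2) ^ (-(n / 2))))) x := by
    convert hasDerivAt_sq_add_sq_rpow hε ((2 - n) / 2) x using 1
    rw [show (2 - n) / 2 - 1 = -(n / 2) by ring]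
    ring
  have hg : Integrable fun x : ℝ => x * (x ^ 2 + ε ^ 2) ^ (-(n / 2)) := by
    refine Integrable.mono' (integrable_sq_add_sq_rpow (by linarith : 1 < n - 1) hε) ?_
      (ae_of_all _ (abs_mul_sq_add_sq_rpow_le hε n))
    exact Measurable.aestronglyMeasurable (by fun_prop)
  have hlim : Tendsto (fun x : ℝ => (x ^ 2 + ε ^ 2) ^ ((2 - n) / 2)) atTop (𝓝 0) := by
    rw [show (2 - n) / 2 = -((n - 2) / 2) by ring]
    exact tendsto_sq_add_sq_rpow_neg ε (by linarith)
  have hint := integral_Ioi_of_hasDerivAt_of_tendsto' (fun x (_ : x ∈ Set.Ici r) => hd x)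
    (hg.const_mul (n - 2)).neg.integrableOn hlim
  rw [integral_neg, integral_const_mul, zero_sub, neg_inj] at hint
  have key := integral_mono hg.integrableOn
    ((integrableOn_integral_Ioi_sq_add_sq_rpow hn hε r).const_mul (n - 1))
    (mul_sq_add_sq_rpow_le_integral_Ioi hn hε)
  rw [integral_const_mul] at key
  rw [← hint, Geps, mul_comm (n - 1), mul_assoc]
  exact mul_le_mul_of_nonneg_left key (by linarith)
end

section
/- Let L > 0, let σ, u : ℝ → ℝ be L-periodic with σ four times and u three times continuously differentiable, and let F : ℝ → ℝ be four times continuously differentiable. Then (1/2) ∫_0^L ( (d²/dx²)[ σ(x) F(u(x)) ] )² dx = ∫_0^L σ(x)² ( (1/2) (F'(u(x)))² (u''(x))² + ( (1/2) (F''(u(x)))² − (1/6) ((F')²)''(u(x)) ) (u'(x))⁴ ) dx − (1/6) ∫_0^L (σ²)'(x) ((F')²)'(u(x)) (u'(x))³ dx + ∫_0^L ( (σ'(x))² − 2 σ(x) σ''(x) ) (F'(u(x)))² (u'(x))² dx + (1/2) ∫_0^L σ(x) σ''''(x) F(u(x))² dx, where ((F')²)' and ((F')²)'' denote the first and second derivatives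 of the function r ↦ (F'(r))² and (σ²)' denotes the derivative of the function x ↦ σ(x)². -/
open MeasureTheory intervalIntegral

lemma ContDiff.hasDerivAt_iteratedDeriv {n : ℕ} {f : ℝ → ℝ} (hf : ContDiff ℝ n f) {k : ℕ}
    (hk : k < n) (x : ℝ) : HasDerivAt (iteratedDeriv k f) (iteratedDeriv (k + 1) f x) x := by
  rw [iteratedDeriv_succ]
  exact (hf.differentiable_iteratedDeriv k (by exact_mod_cast hk) x).hasDerivAt

lemma Function.Periodic.iteratedDeriv {f : ℝ → ℝ} {c : ℝ} (hf : Function.Periodic f c) (k : ℕ) :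
    Function.Periodic (iteratedDeriv k f) c := fun x => by
  rw [← congrFun (iteratedDeriv_comp_add_const k f c) x, funext hf]

lemma iteratedDeriv_two_eq_of_hasDerivAt {f f₁ f₂ : ℝ → ℝ} (h : ∀ x, HasDerivAt f (f₁ x) x)
    (h₁ : ∀ x, HasDerivAt f₁ (f₂ x) x) : iteratedDeriv 2 f = f₂ := by
  rw [iteratedDeriv_succ, iteratedDeriv_one, funext fun x => (h x).deriv,
    funext fun x => (h₁ x).deriv]

lemma integral_eq_zero_of_hasDerivAt_of_periodic {G g : ℝ → ℝ} {c : ℝ}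
    (hG : ∀ x, HasDerivAt G (g x) x) (hg : Continuous g) (hper : Function.Periodic G c) :
    ∫ x in (0 : ℝ)..c, g x = 0 := by
  rw [integral_eq_sub_of_hasDerivAt (fun x _ => hG x) (hg.intervalIntegrable _ _), hper.eq,
    sub_self]

/-- Integration-by-parts identity for the Itô correction term:
for `L > 0`, `L`-periodic `σ` (C⁴) and `u` (C³) and `F : ℝ → ℝ` (C⁴),
`(1/2) ∫_0^L ((d²/dx²)[σ F(u)])² dx` equals the stated combination of integrals. -/
theorem integral_ito_term_identity (L : ℝ) (hL : 0 < L)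
    (σ u : ℝ → ℝ) (hσ : ContDiff ℝ 4 σ) (hσper : Function.Periodic σ L)
    (hu : ContDiff ℝ 3 u) (huper : Function.Periodic u L)
    (F : ℝ → ℝ) (hF : ContDiff ℝ 4 F) :
    (1 / 2) * (∫ x in (0 : ℝ)..L,
        (iteratedDeriv 2 (fun y => σ y * F (u y)) x) ^ 2)
      = (∫ x in (0 : ℝ)..L, (σ x) ^ 2 *
            ((1 / 2) * (deriv F (u x)) ^ 2 * (iteratedDeriv 2 u x) ^ 2
              + ((1 / 2) * (iteratedDeriv 2 F (u x)) ^ 2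
                  - (1 / 6) * iteratedDeriv 2 (fun r => (deriv F r) ^ 2) (u x))
                * (deriv u x) ^ 4))
        - (1 / 6) * (∫ x in (0 : ℝ)..L, deriv (fun y => (σ y) ^ 2) x *
            deriv (fun r => (deriv F r) ^ 2) (u x) * (deriv u x) ^ 3)
        + (∫ x in (0 : ℝ)..L,
            ((deriv σ x) ^ 2 - 2 * σ x * iteratedDeriv 2 σ x)
              * (deriv F (u x)) ^ 2 * (deriv u x) ^ 2)
        + (1 / 2) * ∫ x in (0 : ℝ)..L,
            σ x * iteratedDeriv 4 σ x * (F (u x)) ^ 2 := by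
  have hσd {k : ℕ} (hk : k < 4) (x : ℝ) := ContDiff.hasDerivAt_iteratedDeriv (n := 4) hσ hk x
  have hud {k : ℕ} (hk : k < 3) (x : ℝ) := ContDiff.hasDerivAt_iteratedDeriv (n := 3) hu hk x
  have hFd {k : ℕ} (hk : k < 4) (x : ℝ) := ContDiff.hasDerivAt_iteratedDeriv (n := 4) hF hk x
  have s0 (x) : HasDerivAt σ (deriv σ x) x := by simpa using hσd (k := 0) (by norm_num) x
  have s1 (x) : HasDerivAt (deriv σ) (iteratedDeriv 2 σ x) x := by
    simpa [iteratedDeriv_one] using hσd (k := 1) (by norm_num) x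
  have s2 (x) : HasDerivAt (iteratedDeriv 2 σ) (iteratedDeriv 3 σ x) x := hσd (by norm_num) x
  have s3 (x) : HasDerivAt (iteratedDeriv 3 σ) (iteratedDeriv 4 σ x) x := hσd (by norm_num) x
  have u0 (x) : HasDerivAt u (deriv u x) x := by simpa using hud (k := 0) (by norm_num) x
  have u1 (x) : HasDerivAt (deriv u) (iteratedDeriv 2 u x) x := by
    simpa [iteratedDeriv_one] using hud (k := 1) (by norm_num) x
  have F0 (r) : HasDerivAt F (deriv F r) r := by simpa using hFd (k := 0) (by norm_num) r
  have F1 (r) : HasDerivAt (deriv F) (iteratedDeriv 2 F r) r := by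
    simpa [iteratedDeriv_one] using hFd (k := 1) (by norm_num) r
  have F2 (r) : HasDerivAt (iteratedDeriv 2 F) (iteratedDeriv 3 F r) r := hFd (by norm_num) r
  have Fu0 (x) := (F0 (u x)).comp x (u0 x)
  have Fu1 (x) := (F1 (u x)).comp x (u0 x)
  have Fu2 (x) := (F2 (u x)).comp x (u0 x)
  have cσ : Continuous σ := hσ.continuous
  have cσ1 : Continuous (deriv σ) := hσ.continuous_deriv (by norm_num)
  have cσ2 : Continuous (iteratedDeriv 2 σ) := hσ.continuous_iteratedDeriv 2 (by norm_num)
  have cσ3 : Continuous (iteratedDeriv 3 σ) := hσ.continuous_iteratedDeriv 3 (by norm_num)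
  have cσ4 : Continuous (iteratedDeriv 4 σ) := hσ.continuous_iteratedDeriv 4 (by norm_num)
  have cu : Continuous u := hu.continuous
  have cu1 : Continuous (deriv u) := hu.continuous_deriv (by norm_num)
  have cu2 : Continuous (iteratedDeriv 2 u) := hu.continuous_iteratedDeriv 2 (by norm_num)
  have cF : Continuous F := hF.continuous
  have cF1 : Continuous (deriv F) := hF.continuous_deriv (by norm_num)
  have cF2 : Continuous (iteratedDeriv 2 F) := hF.continuous_iteratedDeriv 2 (by norm_num)
  have cF3 : Continuous (iteratedDeriv 3 F) := hF.continuous_iteratedDeriv 3 (by norm_num)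
  have pσ1 : Function.Periodic (deriv σ) L := by
    simpa [iteratedDeriv_one] using hσper.iteratedDeriv 1
  have pu1 : Function.Periodic (deriv u) L := by
    simpa [iteratedDeriv_one] using huper.iteratedDeriv 1
  have pσ2 := hσper.iteratedDeriv 2
  have pσ3 := hσper.iteratedDeriv 3
  have dσsq (x) : HasDerivAt (fun y => σ y ^ 2) (2 * σ x * deriv σ x) x :=
    ((s0 x).pow 2).congr_deriv (by simp)
  have dH (r) : HasDerivAt (fun r => deriv F r ^ 2) (2 * deriv F r * iteratedDeriv 2 F r) r :=
    ((F1 r).pow 2).congr_deriv (by simp)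
  have dH1 (r) : HasDerivAt (fun r => 2 * deriv F r * iteratedDeriv 2 F r)
      (2 * iteratedDeriv 2 F r ^ 2 + 2 * deriv F r * iteratedDeriv 3 F r) r :=
    (((F1 r).const_mul 2).mul (F2 r)).congr_deriv (by ring)
  have dσF (x) : HasDerivAt (fun y => σ y * F (u y))
      (deriv σ x * F (u x) + σ x * (deriv F (u x) * deriv u x)) x := (s0 x).mul (Fu0 x)
  have dσF1 (x) : HasDerivAt (fun x => deriv σ x * F (u x) + σ x * (deriv F (u x) * deriv u x))
      (iteratedDeriv 2 σ x * F (u x) + 2 * deriv σ x * (deriv F (u x) * deriv u x)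
        + σ x * (iteratedDeriv 2 F (u x) * deriv u x ^ 2 + deriv F (u x) * iteratedDeriv 2 u x))
      x :=
    (((s1 x).mul (Fu0 x)).add ((s0 x).mul ((Fu1 x).mul (u1 x)))).congr_deriv (by
      simp only [Function.comp_apply, Pi.mul_apply]; ring)
  rw [iteratedDeriv_two_eq_of_hasDerivAt dσF dσF1, iteratedDeriv_two_eq_of_hasDerivAt dH dH1,
    funext fun x => (dσsq x).deriv, funext fun r => (dH r).deriv]
  simp only [← intervalIntegral.integral_const_mul]
  rw [← integral_sub (Continuous.intervalIntegrable (by fun_prop) _ _)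
      (Continuous.intervalIntegrable (by fun_prop) _ _),
    ← integral_add (Continuous.intervalIntegrable (by fun_prop) _ _)
      (Continuous.intervalIntegrable (by fun_prop) _ _),
    ← integral_add (Continuous.intervalIntegrable (by fun_prop) _ _)
      (Continuous.intervalIntegrable (by fun_prop) _ _),
    ← sub_eq_zero, ← integral_sub (Continuous.intervalIntegrable (by fun_prop) _ _)
      (Continuous.intervalIntegrable (by fun_prop) _ _)]
  refine integral_eq_zero_of_hasDerivAt_of_periodic
    (G := fun x => 1 / 3 * (σ x ^ 2 * (deriv F (u x) * iteratedDeriv 2 F (u x)) * deriv u x ^ 3)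
      + σ x * deriv σ x * (deriv F (u x) * deriv u x) ^ 2
      + σ x * iteratedDeriv 2 σ x * (F (u x) * (deriv F (u x) * deriv u x))
      + 1 / 2 * ((deriv σ x * iteratedDeriv 2 σ x - σ x * iteratedDeriv 3 σ x) * F (u x) ^ 2))
    (fun x => ?_) (by fun_prop) (fun x => ?_)
  · have v1 := (Fu1 x).mul (u1 x)
    refine (((((((s0 x).pow 2).mul ((Fu1 x).mul (Fu2 x))).mul ((u1 x).pow 3)).const_mul
      (1 / 3)).add (((s0 x).mul (s1 x)).mul (v1.pow 2))).add
      (((s0 x).mul (s2 x)).mul ((Fu0 x).mul v1)) |>.add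
      (((((s1 x).mul (s2 x)).sub ((s0 x).mul (s3 x))).mul ((Fu0 x).pow 2)).const_mul
      (1 / 2))).congr_deriv ?_
    simp only [Function.comp_apply, Pi.mul_apply, Pi.pow_apply, Pi.sub_apply]
    push_cast
    ring
  · simp only [hσper x, huper x, pσ1 x, pu1 x, pσ2 x, pσ3 x]
end
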